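/- arXiv:1201.3898 — 8 statements merged into one kernel-verified Lean document; each statement's English description precedes it below -/
import Mathlib

section
/- If a 2-algebra (T, t₀, t₁) is homotopy-initial, then T satisfies the dependent elimination rule with propositional computation rules: for every type family C : T → Type and elements c₀ : C t₀ and c₁ : C t₁, there exists a dependent function s : ∀ x : T, C x together with equalities s t₀ = c₀ and s t₁ = c₁. -/
universe u

/-- A type is contractible if the type `Σ x : A, ∀ y : A, x = y` is inhabited. -/
def IsContr (A : Sort*) : Prop := ∃ x : A, ∀ y : A, x = y

/-- The type of weak 2-algebra homomorphisms `(C, c₀, c₁) → (D, d₀, d₁)`. -/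
def TwoAlgHom {C D : Type*} (c₀ c₁ : C) (d₀ d₁ : D) : Type _ :=
  Σ' f : C → D, (f c₀ = d₀) ∧ (f c₁ = d₁)

theorem Sigma.transport_snd_eq {T : Type*} {C : T → Type*} {t : T} {c : C t} {y : Sigma C}
    (hy : y = ⟨t, c⟩) (h : y.1 = t) : (h ▸ y.2 : C t) = c := by
  subst hy
  rfl

theorem IsContr.eq {A : Sort*} (hA : IsContr A) (x y : A) : x = y := by
  obtain ⟨a, ha⟩ := hA
  exact (ha x).symm.trans (ha y)

theorem two_elim_of_hinitial {T : Type u} (t₀ t₁ : T)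
    (hinit : ∀ (D : Type u) (d₀ d₁ : D), IsContr (TwoAlgHom t₀ t₁ d₀ d₁))
    (C : T → Type u) (c₀ : C t₀) (c₁ : C t₁) :
    ∃ s : ∀ x : T, C x, s t₀ = c₀ ∧ s t₁ = c₁ := by
  obtain ⟨⟨f, hf₀, hf₁⟩, -⟩ := hinit (Sigma C) ⟨t₀, c₀⟩ ⟨t₁, c₁⟩
  let g : TwoAlgHom t₀ t₁ t₀ t₁ :=
    ⟨fun x => (f x).1, congrArg Sigma.fst hf₀, congrArg Sigma.fst hf₁⟩
  have hg : g = ⟨id, rfl, rfl⟩ := (hinit T t₀ t₁).eq _ _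
  have section_fst : ∀ x, (f x).1 = x := congrFun (congrArg PSigma.fst hg)
  exact ⟨fun x => section_fst x ▸ (f x).2,
    Sigma.transport_snd_eq hf₀ _, Sigma.transport_snd_eq hf₁ _⟩
end

section
/- The ℕ-algebra (ℕ, 0, Nat.succ) is homotopy-initial: for every type C with c₀ : C and cs : C → C, the type Σ f : ℕ → C, (f 0 = c₀) × (f ∘ Nat.succ = cs ∘ f) of weak ℕ-algebra homomorphisms is contractible. -/
/-- The type of weak ℕ-algebra homomorphisms `(C, c₀, cs) → (D, d₀, ds)`. -/
def NatAlgHom {C D : Type*} (c₀ : C) (cs : C → C) (d₀ : D) (ds : D → D) : Type _ :=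
  Σ' f : C → D, (f c₀ = d₀) ∧ (f ∘ cs = ds ∘ f)

theorem nat_algebra_hinitial {C : Type*} (c₀ : C) (cs : C → C) :
    IsContr (NatAlgHom (C := ℕ) 0 Nat.succ c₀ cs) := by
  refine ⟨⟨Nat.rec c₀ fun _ => cs, rfl, rfl⟩, ?_⟩
  rintro ⟨f, h₀, hs⟩
  have hf : (Nat.rec c₀ fun _ => cs : ℕ → C) = f := by
    funext n
    induction n with
    | zero => exact h₀.symm
    | succ n ih => exact (congrArg cs ih).trans (congrFun hs n).symm
  subst hf
  rfl
end

section
/- If a ℕ-algebra (N, z, s) is homotopy-initial, then N satisfies the dependent elimination rule with propositional computation rules: for every type family C : N → Type, element c₀ : C z, and function cs : ∀ n : N, C n → C (s n), there exists a dependent function r : ∀ n : N, C n together with an equality r z = c₀ and a family of equalities ∀ n : N, r (s n) = cs n (r n). -/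
universe u

/-- If the type of algebra homomorphisms is contractible, any two have the same underlying map. -/
theorem NatAlgHom.fst_eq_of_isContr {C D : Type*} {c₀ : C} {cs : C → C} {d₀ : D} {ds : D → D}
    (h : IsContr (NatAlgHom c₀ cs d₀ ds)) (f g : NatAlgHom c₀ cs d₀ ds) : f.1 = g.1 := by
  obtain ⟨x, hx⟩ := h
  rw [← hx f, ← hx g]

/-- A map into the total space whose first projection is the identity is given by a section. -/
theorem exists_section_of_fst_comp_eq_id {N : Type*} {C : N → Type*} (f : N → Σ n, C n)
    (hf : Sigma.fst ∘ f = id) : ∃ r : ∀ n, C n, ∀ n, f n = ⟨n, r n⟩ := by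
  have h (n : N) : ∃ c : C n, f n = ⟨n, c⟩ := by
    rcases hfn : f n with ⟨m, c⟩
    have hm : m = n := by simpa [hfn] using congrFun hf n
    subst hm
    exact ⟨c, rfl⟩
  exact ⟨fun n => (h n).choose, fun n => (h n).choose_spec⟩

theorem nat_elim_of_hinitial {N : Type u} (z : N) (s : N → N)
    (hinit : ∀ (D : Type u) (d₀ : D) (ds : D → D), IsContr (NatAlgHom z s d₀ ds))
    (C : N → Type u) (c₀ : C z) (cs : ∀ n : N, C n → C (s n)) :
    ∃ r : ∀ n : N, C n, r z = c₀ ∧ ∀ n : N, r (s n) = cs n (r n) := by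
  let ds : (Σ n, C n) → Σ n, C n := fun x => ⟨s x.1, cs x.1 x.2⟩
  obtain ⟨⟨f, hz, hs⟩, -⟩ := hinit (Σ n, C n) ⟨z, c₀⟩ ds
  have hfst : Sigma.fst ∘ f = id :=
    NatAlgHom.fst_eq_of_isContr (hinit N z s)
      ⟨Sigma.fst ∘ f, congrArg Sigma.fst hz, congrArg (Sigma.fst ∘ ·) hs⟩ ⟨id, rfl, rfl⟩
  obtain ⟨r, hr⟩ := exists_section_of_fst_comp_eq_id f hfst
  refine ⟨r, eq_of_heq (Sigma.mk.inj ((hr z).symm.trans hz)).2, fun n => ?_⟩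
  have hsn : f (s n) = ds (f n) := congrFun hs n
  rw [hr, hr n] at hsn
  exact eq_of_heq (Sigma.mk.inj hsn).2
end

section
/- For every type A and type family B : A → Type, the P-algebra (WType B, sW), where sW ⟨a, u⟩ := WType.mk a u, is homotopy-initial: for every type C with structure map sC : (Σ a : A, B a → C) → C, the type Σ f : WType B → C, f ∘ sW = sC ∘ Pmap f of weak P-algebra homomorphisms is contractible. -/
universe u v w

/-- The action of the polynomial functor `P X = Σ a : A, B a → X` on a map `f : X → Y`. -/
def Pmap {A : Type u} {B : A → Type v} {X Y : Type*} (f : X → Y) :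
    (Σ a : A, B a → X) → Σ a : A, B a → Y :=
  fun p => ⟨p.1, f ∘ p.2⟩

/-- The canonical P-algebra structure map on `WType B`. -/
def sW {A : Type u} (B : A → Type v) : (Σ a : A, B a → WType B) → WType B :=
  fun p => WType.mk p.1 p.2

theorem wtype_hinitial {A : Type u} {B : A → Type v} {C : Type w}
    (sC : (Σ a : A, B a → C) → C) :
    IsContr (Σ' f : WType B → C, f ∘ sW B = sC ∘ Pmap f) := by
  refine ⟨⟨WType.elim C sC, rfl⟩, ?_⟩
  rintro ⟨g, hg⟩
  obtain rfl : WType.elim C sC = g := by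
    funext x
    induction x with
    | mk a u ih =>
      calc
        WType.elim C sC (WType.mk a u) = sC (Pmap (WType.elim C sC) ⟨a, u⟩) := rfl
        _ = sC (Pmap g ⟨a, u⟩) := congrArg (fun k => sC ⟨a, k⟩) (funext ih)
        _ = g (WType.mk a u) := (congrFun hg ⟨a, u⟩).symm
  rfl
end

section
/- If a P-algebra (W, sW) is homotopy-initial, then W satisfies the dependent W-elimination rule with propositional computation rule: for every type family C : W → Type and function c : ∀ (a : A) (u : B a → W), (∀ y : B a, C (u y)) → C (sW ⟨a, u⟩), there exists a dependent function r : ∀ w : W, C w together with a family of equalities ∀ (a : A) (u : B a → W), r (sW ⟨a, u⟩) = c a u (fun y => r (u y)). -/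
universe u v w

theorem w_elim_of_hinitial {A : Type u} {B : A → Type v} {W : Type w}
    (sW : (Σ a : A, B a → W) → W)
    (hinit : ∀ (D : Type w) (sD : (Σ a : A, B a → D) → D),
      IsContr (Σ' f : W → D, f ∘ sW = sD ∘ Pmap f))
    (C : W → Type w)
    (c : ∀ (a : A) (u : B a → W), (∀ y : B a, C (u y)) → C (sW ⟨a, u⟩)) :
    ∃ r : ∀ w : W, C w,
      ∀ (a : A) (u : B a → W), r (sW ⟨a, u⟩) = c a u (fun y => r (u y)) := by
  let sD : (Σ a : A, B a → Σ w, C w) → Σ w, C w := fun p =>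
    ⟨sW ⟨p.1, fun y => (p.2 y).1⟩, c p.1 (fun y => (p.2 y).1) (fun y => (p.2 y).2)⟩
  obtain ⟨⟨f, hf⟩, -⟩ := hinit _ sD
  have fst_f : Sigma.fst ∘ f = id := by
    obtain ⟨g, hg⟩ := hinit W sW
    have hom_fst : (Sigma.fst ∘ f) ∘ sW = sW ∘ Pmap (Sigma.fst ∘ f) := by
      rw [Function.comp_assoc, hf]
      rfl
    exact congrArg PSigma.fst ((hg ⟨_, hom_fst⟩).symm.trans (hg ⟨id, rfl⟩))
  have exists_snd (w : W) : ∃ x : C w, f w = ⟨w, x⟩ := by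
    have fst_eq : (f w).1 = w := congrFun fst_f w
    generalize f w = p at fst_eq
    subst fst_eq
    exact ⟨p.2, rfl⟩
  choose r hr using exists_snd
  obtain rfl : f = fun w => ⟨w, r w⟩ := funext hr
  exact ⟨r, fun a u => eq_of_heq (Sigma.mk.inj (congrFun hf ⟨a, u⟩)).2⟩
end

section
/- The natural numbers can be defined as a W-type: for the branching family B : Bool → Type with B false := PEmpty and B true := PUnit, the ℕ-algebra on WType B given by z := WType.mk false PEmpty.elim and s n := WType.mk true (fun _ => n) is homotopy-initial, i.e., for every type C with c₀ : C and cs : C → C, the type Σ f : WType B → C, (f z = c₀) × (f ∘ s = cs ∘ f) is contractible. -/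
/-- The branching family for the natural numbers as a W-type. -/
def NatBranch : Bool → Type
  | false => PEmpty
  | true => PUnit

/-- Zero, as an element of the W-type of natural numbers. -/
def natW_zero : WType NatBranch := WType.mk false PEmpty.elim

/-- Successor, as a map on the W-type of natural numbers. -/
def natW_succ (n : WType NatBranch) : WType NatBranch := WType.mk true (fun _ => n)

theorem natW_mk_false (g : NatBranch false → WType NatBranch) :
    WType.mk false g = natW_zero :=
  congrArg (WType.mk false) (funext fun x => PEmpty.elim x)

theorem natW_mk_true (g : NatBranch true → WType NatBranch) :
    WType.mk true g = natW_succ (g PUnit.unit) :=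
  rfl

/-- The induction principle of the natural numbers, for the W-type of natural numbers. -/
theorem natW_induction {P : WType NatBranch → Prop} (zero : P natW_zero)
    (succ : ∀ n, P n → P (natW_succ n)) (n : WType NatBranch) : P n := by
  induction n with
  | mk b g ih =>
    cases b with
    | false => exact natW_mk_false g ▸ zero
    | true => exact natW_mk_true g ▸ succ _ (ih PUnit.unit)

/-- The recursor into an `ℕ`-algebra, for the W-type of natural numbers. -/
def natW_rec {C : Type*} (c₀ : C) (cs : C → C) : WType NatBranch → C :=
  WType.elim C fun
    | ⟨false, _⟩ => c₀
    | ⟨true, h⟩ => cs (h PUnit.unit)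

theorem natW_hom_ext {C : Type*} {c₀ : C} {cs : C → C} {f g : WType NatBranch → C}
    (hf₀ : f natW_zero = c₀) (hfs : f ∘ natW_succ = cs ∘ f)
    (hg₀ : g natW_zero = c₀) (hgs : g ∘ natW_succ = cs ∘ g) : f = g :=
  funext <| natW_induction (hf₀.trans hg₀.symm) fun n ih =>
    (congrFun hfs n).trans <| (congrArg cs ih).trans (congrFun hgs n).symm

theorem natW_hinitial {C : Type*} (c₀ : C) (cs : C → C) :
    IsContr (Σ' f : WType NatBranch → C,
      (f natW_zero = c₀) ∧ (f ∘ natW_succ = cs ∘ f)) := by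
  refine ⟨⟨natW_rec c₀ cs, rfl, rfl⟩, ?_⟩
  rintro ⟨g, hg₀, hgs⟩
  obtain rfl : natW_rec c₀ cs = g := natW_hom_ext rfl rfl hg₀ hgs
  rfl
end

section
/- Function extensionality for non-dependent functions implies function extensionality for dependent functions: if for all types A, B and all functions f, g : A → B, (∀ x : A, f x = g x) implies f = g, then for all types A, all type families B : A → Type, and all dependent functions f, g : ∀ x : A, B x, (∀ x : A, f x = g x) implies f = g. -/
universe u v

/-- The dependent function determined by a section of the first projection of a sigma type. -/
def Sigma.sectionToPi {A : Type u} {B : A → Type v} (s : ULift.{v} A → Sigma B)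
    (hs : ∀ x : A, (s ⟨x⟩).1 = x) : ∀ x : A, B x :=
  fun x => hs x ▸ (s ⟨x⟩).2

theorem Sigma.sectionToPi_congr {A : Type u} {B : A → Type v} {s t : ULift.{v} A → Sigma B}
    (hst : s = t) (hs : ∀ x : A, (s ⟨x⟩).1 = x) (ht : ∀ x : A, (t ⟨x⟩).1 = x) :
    Sigma.sectionToPi s hs = Sigma.sectionToPi t ht := by
  subst hst
  rfl

theorem dep_funext_of_funext
    (hfe : ∀ (A B : Type (max u v)) (f g : A → B), (∀ x : A, f x = g x) → f = g)
    (A : Type u) (B : A → Type v) (f g : ∀ x : A, B x)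
    (h : ∀ x : A, f x = g x) : f = g := by
  have hs : (fun x : ULift.{v} A => (⟨x.down, f x.down⟩ : Sigma B)) =
      fun x => ⟨x.down, g x.down⟩ :=
    hfe _ _ _ _ fun x => congrArg (Sigma.mk x.down) (h x.down)
  exact Sigma.sectionToPi_congr hs (fun _ => rfl) (fun _ => rfl)
end

section
/- The second number class can be defined as a W-type: there exist a type O together with z : O, s : O → O, and l : (ℕ → O) → O such that the resulting algebra is homotopy-initial, i.e., for every type C with c₀ : C, cs : C → C, and cl : (ℕ → C) → C, the type Σ f : O → C, (f z = c₀) × (f ∘ s = cs ∘ f) × (∀ g : ℕ → O, f (l g) = cl (f ∘ g)) is contractible. -/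
/-- The constructors of the second number class: zero, successor and limit. -/
inductive SecondNumberClass.Shape : Type
  | zero
  | succ
  | lim

namespace SecondNumberClass

/-- The number of recursive arguments of each constructor. -/
def Arity : Shape → Type
  | .zero => Empty
  | .succ => Unit
  | .lim => ℕ

/-- The second number class as a W-type. -/
abbrev Ord : Type := WType Arity

/-- The zero of the second number class. -/
def Ord.zero : Ord := ⟨Shape.zero, Empty.elim⟩

/-- The successor operation on the second number class. -/
def Ord.succ (x : Ord) : Ord := ⟨Shape.succ, fun _ : Unit => x⟩

/-- The limit operation on the second number class. -/
def Ord.lim (g : ℕ → Ord) : Ord := ⟨Shape.lim, g⟩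

/-- The induction principle of the second number class. -/
theorem Ord.induction {p : Ord → Prop} (zero : p Ord.zero) (succ : ∀ x, p x → p x.succ)
    (lim : ∀ g : ℕ → Ord, (∀ n, p (g n)) → p (Ord.lim g)) (x : Ord) : p x := by
  induction x with
  | mk a g ih =>
    cases a with
    | zero =>
      have hg : g = Empty.elim := funext fun e : Empty => e.elim
      exact hg ▸ zero
    | succ => exact succ (g ()) (ih ())
    | lim => exact lim g ih

/-- The structure map of an algebra, assembled from its three operations. -/
def structureMap {C : Type*} (c₀ : C) (cs : C → C) (cl : (ℕ → C) → C) :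
    (Σ a : Shape, Arity a → C) → C
  | ⟨.zero, _⟩ => c₀
  | ⟨.succ, x⟩ => cs (x ())
  | ⟨.lim, g⟩ => cl g

/-- The recursor of the second number class. -/
def Ord.recursor {C : Type*} (c₀ : C) (cs : C → C) (cl : (ℕ → C) → C) : Ord → C :=
  WType.elim C (structureMap c₀ cs cl)

/-- Weak homomorphisms out of the second number class are equal as functions. -/
theorem Ord.hom_ext {C : Type*} {c₀ : C} {cs : C → C} {cl : (ℕ → C) → C} {f f' : Ord → C}
    (hf : f Ord.zero = c₀ ∧ f ∘ Ord.succ = cs ∘ f ∧ ∀ g, f (Ord.lim g) = cl (f ∘ g))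
    (hf' : f' Ord.zero = c₀ ∧ f' ∘ Ord.succ = cs ∘ f' ∧ ∀ g, f' (Ord.lim g) = cl (f' ∘ g)) :
    f = f' := by
  funext x
  induction x using Ord.induction with
  | zero => exact hf.1.trans hf'.1.symm
  | succ x ih =>
    exact (congrFun hf.2.1 x).trans ((congrArg cs ih).trans (congrFun hf'.2.1 x).symm)
  | lim g ih => rw [hf.2.2, hf'.2.2, show f ∘ g = f' ∘ g from funext ih]

end SecondNumberClass

open SecondNumberClass in
theorem second_number_class_as_wtype :
    ∃ (O : Type) (z : O) (s : O → O) (l : (ℕ → O) → O),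
      ∀ (C : Type) (c₀ : C) (cs : C → C) (cl : (ℕ → C) → C),
        IsContr (Σ' f : O → C,
          (f z = c₀) ∧ (f ∘ s = cs ∘ f) ∧ (∀ g : ℕ → O, f (l g) = cl (f ∘ g))) := by
  refine ⟨Ord, Ord.zero, Ord.succ, Ord.lim, fun C c₀ cs cl =>
    ⟨⟨Ord.recursor c₀ cs cl, rfl, rfl, fun _ => rfl⟩, ?_⟩⟩
  rintro ⟨f, hf⟩
  obtain rfl : Ord.recursor c₀ cs cl = f := Ord.hom_ext ⟨rfl, rfl, fun _ => rfl⟩ hf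
  rfl
end
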